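/- arXiv:1406.3587 — 8 statements merged into one kernel-verified Lean document; each statement's English description precedes it below -/
import Mathlib

section
/- Constant rules for the GHR derivative: let f : ℍ → ℍ be differentiable at q and let μ ∈ ℍ be nonzero. Then (a) for every ν ∈ ℍ, the GHR derivative of the left-scaled function p ↦ ν * f p satisfies ∂(ν f)/∂q^μ(q) = ν * (∂f/∂q^μ(q)); and (b) for every nonzero ν ∈ ℍ, the GHR derivative of the right-scaled function p ↦ f p * ν satisfies ∂(f ν)/∂q^μ(q) = (∂f/∂q^{νμ}(q)) * ν, where νμ denotes the quaternion product ν * μ. -/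
open Quaternion

/-- The quaternion imaginary unit `i`. -/
def qi : ℍ[ℝ] := ⟨0, 1, 0, 0⟩
/-- The quaternion imaginary unit `j`. -/
def qj : ℍ[ℝ] := ⟨0, 0, 1, 0⟩
/-- The quaternion imaginary unit `k`. -/
def qk : ℍ[ℝ] := ⟨0, 0, 0, 1⟩

/-- The left GHR derivative of `f : ℍ → ℍ` at `q` with rotation parameter `μ`:
`∂f/∂q^μ(q) = (1/4)(D_1 f(q) − D_i f(q)·(μiμ⁻¹) − D_j f(q)·(μjμ⁻¹) − D_k f(q)·(μkμ⁻¹))`. -/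
noncomputable def ghrD (f : ℍ[ℝ] → ℍ[ℝ]) (μ q : ℍ[ℝ]) : ℍ[ℝ] :=
  (4 : ℝ)⁻¹ • (fderiv ℝ f q 1 - fderiv ℝ f q qi * (μ * qi * μ⁻¹)
    - fderiv ℝ f q qj * (μ * qj * μ⁻¹) - fderiv ℝ f q qk * (μ * qk * μ⁻¹))

/-- The left GHR derivative of `f : ℍ → ℍ` at `q` with respect to the conjugate rotated
variable `q^{μ*}`:
`∂f/∂q^{μ*}(q) = (1/4)(D_1 f(q) + D_i f(q)·(μiμ⁻¹) + D_j f(q)·(μjμ⁻¹) + D_k f(q)·(μkμ⁻¹))`. -/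
noncomputable def ghrDStar (f : ℍ[ℝ] → ℍ[ℝ]) (μ q : ℍ[ℝ]) : ℍ[ℝ] :=
  (4 : ℝ)⁻¹ • (fderiv ℝ f q 1 + fderiv ℝ f q qi * (μ * qi * μ⁻¹)
    + fderiv ℝ f q qj * (μ * qj * μ⁻¹) + fderiv ℝ f q qk * (μ * qk * μ⁻¹))

/-- Constant rules for the GHR derivative: left scaling by a constant `ν` pulls out on the
left, and right scaling by a nonzero constant `ν` transforms the rotation parameter:
`∂(νf)/∂q^μ = ν ∂f/∂q^μ` and `∂(fν)/∂q^μ = (∂f/∂q^{νμ}) ν`. -/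
theorem ghr_constant_rules (f : ℍ[ℝ] → ℍ[ℝ]) (q : ℍ[ℝ]) (hf : DifferentiableAt ℝ f q)
    (μ : ℍ[ℝ]) (hμ : μ ≠ 0) :
    (∀ ν : ℍ[ℝ], ghrD (fun p => ν * f p) μ q = ν * ghrD f μ q) ∧
    (∀ ν : ℍ[ℝ], ν ≠ 0 → ghrD (fun p => f p * ν) μ q = ghrD f (ν * μ) q * ν) := by
  refine ⟨fun ν => ?_, fun ν hν => ?_⟩
  · simp only [ghrD, fderiv_const_mul hf, smul_apply, smul_eq_mul,
      mul_smul_comm, mul_sub, mul_assoc]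
  · have hinv : (ν * μ)⁻¹ * ν = μ⁻¹ := by
      rw [mul_inv_rev, mul_assoc, inv_mul_cancel₀ hν, mul_one]
    simp only [ghrD, fderiv_mul_const' hf, smul_apply, MulOpposite.smul_eq_mul_unop,
      MulOpposite.unop_op, smul_mul_assoc, sub_mul, mul_assoc, hinv]
end

section
/- Product rule for the GHR derivative: let f, g : ℍ → ℍ be differentiable at q, let μ ∈ ℍ be nonzero, and suppose g(q) ≠ 0. Then the pointwise product fg : p ↦ f p * g p satisfies ∂(fg)/∂q^μ(q) = f(q) * (∂g/∂q^μ(q)) + (∂f/∂q^{g(q)μ}(q)) * g(q), where g(q)μ denotes the quaternion product g(q) * μ. -/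
open Quaternion

/-- Rotating by `a * μ` and then multiplying by `a` is multiplying by `a` and then rotating
by `μ`. -/
theorem mul_conj_mul_self {D : Type*} [DivisionRing D] {a : D} (ha : a ≠ 0) (μ u : D) :
    a * μ * u * (a * μ)⁻¹ * a = a * (μ * u * μ⁻¹) := by
  simp [mul_assoc, ha]

/-- Product rule for the GHR derivative:
`∂(fg)/∂q^μ(q) = f(q) ∂g/∂q^μ(q) + (∂f/∂q^{g(q)μ}(q)) g(q)`. -/
theorem ghr_product_rule (f g : ℍ[ℝ] → ℍ[ℝ]) (q : ℍ[ℝ])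
    (hf : DifferentiableAt ℝ f q) (hg : DifferentiableAt ℝ g q)
    (μ : ℍ[ℝ]) (hμ : μ ≠ 0) (hgq : g q ≠ 0) :
    ghrD (fun p => f p * g p) μ q
      = f q * ghrD g μ q + ghrD f (g q * μ) q * g q := by
  have key (v : ℍ[ℝ]) : fderiv ℝ (fun p => f p * g p) q v
      = f q * fderiv ℝ g q v + fderiv ℝ f q v * g q := by
    simp [fderiv_fun_mul' hf hg]
  simp only [ghrD, key, mul_smul_comm, smul_mul_assoc, ← smul_add, sub_mul,
    mul_assoc (fderiv ℝ f q _) _ (g q), mul_conj_mul_self hgq]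
  congr 1
  noncomm_ring
end

section
/- Conjugate product rule for the GHR derivative: let f, g : ℍ → ℍ be differentiable at q, let μ ∈ ℍ be nonzero, and suppose g(q) ≠ 0. Then the pointwise product fg : p ↦ f p * g p satisfies ∂(fg)/∂q^{μ*}(q) = f(q) * (∂g/∂q^{μ*}(q)) + (∂f/∂q^{g(q)μ*}(q)) * g(q), where ∂f/∂q^{g(q)μ*} denotes the conjugate GHR derivative with rotation parameter g(q) * μ. -/
open Quaternion

/-- Rotating by `a * μ` and then multiplying by `a` on the right is rotating by `μ` after
multiplying by `a` on the left. -/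
theorem mul_conj_mul_right {D : Type*} [DivisionRing D] {a : D} (ha : a ≠ 0) (x μ v : D) :
    x * (a * μ * v * (a * μ)⁻¹) * a = x * a * (μ * v * μ⁻¹) := by
  simp only [mul_inv_rev, mul_assoc, inv_mul_cancel₀ ha, mul_one]

/-- Conjugate product rule for the GHR derivative:
`∂(fg)/∂q^{μ*}(q) = f(q) ∂g/∂q^{μ*}(q) + (∂f/∂q^{g(q)μ*}(q)) g(q)`. -/
theorem ghr_conj_product_rule (f g : ℍ[ℝ] → ℍ[ℝ]) (q : ℍ[ℝ])
    (hf : DifferentiableAt ℝ f q) (hg : DifferentiableAt ℝ g q)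
    (μ : ℍ[ℝ]) (hμ : μ ≠ 0) (hgq : g q ≠ 0) :
    ghrDStar (fun p => f p * g p) μ q
      = f q * ghrDStar g μ q + ghrDStar f (g q * μ) q * g q := by
  have hD (v : ℍ[ℝ]) : fderiv ℝ (fun p => f p * g p) q v
      = f q * fderiv ℝ g q v + fderiv ℝ f q v * g q := by
    simp [fderiv_fun_mul' hf hg]
  simp only [ghrDStar, hD, mul_smul_comm, smul_mul_assoc, ← smul_add, add_mul, mul_add,
    mul_conj_mul_right hgq, ← mul_assoc (f q)]
  congr 1
  abel
end

section
/- Chain rule for the GHR derivative: let g : ℍ → ℍ be differentiable at q, let f : ℍ → ℍ be differentiable at g(q), and let μ ∈ ℍ be nonzero. Then the composition f ∘ g satisfies ∂(f∘g)/∂q^μ(q) = Σ_{ν ∈ {1, i, j, k}} (∂f/∂p^ν(g(q))) * (∂g^ν/∂q^μ(q)), where ∂f/∂p^ν(g(q)) is the left GHR derivative of f at the point g(q) with rotation parameter ν, and g^ν : ℍ → ℍ is the function p ↦ ν * g(p) * ν⁻¹. -/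
open Quaternion

@[simp] theorem qi_re : qi.re = 0 := rfl
@[simp] theorem qi_imI : qi.imI = 1 := rfl
@[simp] theorem qi_imJ : qi.imJ = 0 := rfl
@[simp] theorem qi_imK : qi.imK = 0 := rfl

@[simp] theorem qj_re : qj.re = 0 := rfl
@[simp] theorem qj_imI : qj.imI = 0 := rfl
@[simp] theorem qj_imJ : qj.imJ = 1 := rfl
@[simp] theorem qj_imK : qj.imK = 0 := rfl

@[simp] theorem qk_re : qk.re = 0 := rfl
@[simp] theorem qk_imI : qk.imI = 0 := rfl
@[simp] theorem qk_imJ : qk.imJ = 0 := rfl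
@[simp] theorem qk_imK : qk.imK = 1 := rfl

theorem qi_inv : qi⁻¹ = -qi :=
  inv_eq_of_mul_eq_one_right (by ext <;> simp)

theorem qj_inv : qj⁻¹ = -qj :=
  inv_eq_of_mul_eq_one_right (by ext <;> simp)

theorem qk_inv : qk⁻¹ = -qk :=
  inv_eq_of_mul_eq_one_right (by ext <;> simp)

theorem eq_smul_basis (x : ℍ[ℝ]) :
    x = x.re • (1 : ℍ[ℝ]) + x.imI • qi + x.imJ • qj + x.imK • qk := by
  ext <;> simp

/-- The differential of `f` is the sum over `ν` of the rotations `x ↦ ν * x * ν⁻¹`, weighted on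
the left by the GHR derivatives of `f`. -/
theorem fderiv_apply_eq_sum_ghrD (f : ℍ[ℝ] → ℍ[ℝ]) (p x : ℍ[ℝ]) :
    fderiv ℝ f p x = ghrD f 1 p * (1 * x * 1⁻¹) + ghrD f qi p * (qi * x * qi⁻¹)
      + ghrD f qj p * (qj * x * qj⁻¹) + ghrD f qk p * (qk * x * qk⁻¹) := by
  conv_lhs => rw [eq_smul_basis x]
  simp only [map_add, map_smul, ghrD, qi_inv, qj_inv, qk_inv, inv_one]
  generalize fderiv ℝ f p 1 = a
  generalize fderiv ℝ f p qi = b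
  generalize fderiv ℝ f p qj = c
  generalize fderiv ℝ f p qk = d
  ext <;> simp <;> ring

theorem fderiv_conj_apply {g : ℍ[ℝ] → ℍ[ℝ]} {q : ℍ[ℝ]} (hg : DifferentiableAt ℝ g q)
    (ν v : ℍ[ℝ]) :
    fderiv ℝ (fun p => ν * g p * ν⁻¹) q v = ν * fderiv ℝ g q v * ν⁻¹ := by
  rw [fderiv_mul_const' (hg.const_mul ν), fderiv_const_mul hg]
  simp

/-- Chain rule for the GHR derivative:
`∂(f∘g)/∂q^μ(q) = Σ_{ν ∈ {1,i,j,k}} (∂f/∂p^ν(g(q))) (∂g^ν/∂q^μ(q))`,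
where `g^ν(p) = ν * g(p) * ν⁻¹`. -/
theorem ghr_chain_rule (f g : ℍ[ℝ] → ℍ[ℝ]) (q : ℍ[ℝ])
    (hg : DifferentiableAt ℝ g q) (hf : DifferentiableAt ℝ f (g q))
    (μ : ℍ[ℝ]) (hμ : μ ≠ 0) :
    ghrD (f ∘ g) μ q
      = ghrD f 1 (g q) * ghrD (fun p => 1 * g p * 1⁻¹) μ q
      + ghrD f qi (g q) * ghrD (fun p => qi * g p * qi⁻¹) μ q
      + ghrD f qj (g q) * ghrD (fun p => qj * g p * qj⁻¹) μ q
      + ghrD f qk (g q) * ghrD (fun p => qk * g p * qk⁻¹) μ q := by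
  have hcomp (v : ℍ[ℝ]) : fderiv ℝ (f ∘ g) q v = fderiv ℝ f (g q) (fderiv ℝ g q v) := by
    rw [fderiv_comp q hf hg, ContinuousLinearMap.comp_apply]
  simp only [ghrD.eq_1 (f ∘ g), hcomp, fderiv_apply_eq_sum_ghrD f, ← fderiv_conj_apply hg]
  simp only [ghrD.eq_1 (fun _ => _), mul_smul_comm, ← smul_add, mul_sub, add_mul, mul_assoc]
  congr 1
  abel
end

section
/- Conjugate rule for real-valued functions: let f : ℍ → ℝ be differentiable at q and let μ ∈ ℍ be nonzero. Identifying f with the ℍ-valued function q ↦ ((f q : ℝ) : ℍ), the GHR derivatives satisfy star (∂f/∂q^μ(q)) = ∂f/∂q^{μ*}(q) and star (∂f/∂q^{μ*}(q)) = ∂f/∂q^μ(q), where star denotes quaternion conjugation. -/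
open Quaternion

theorem Quaternion.star_conj_of_star_eq_neg {x : ℍ[ℝ]} (hx : star x = -x) (μ : ℍ[ℝ]) :
    star (μ * x * μ⁻¹) = -(μ * x * μ⁻¹) := by
  rw [show μ⁻¹ = (normSq μ)⁻¹ • star μ from rfl]
  simp [hx, mul_assoc]

theorem star_qi : star qi = -qi := Quaternion.star_eq_neg.2 rfl

theorem star_qj : star qj = -qj := Quaternion.star_eq_neg.2 rfl

theorem star_qk : star qk = -qk := Quaternion.star_eq_neg.2 rfl

theorem fderiv_quaternion_coe_apply {E : Type*} [NormedAddCommGroup E] [NormedSpace ℝ E]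
    {f : E → ℝ} {x : E} (hf : DifferentiableAt ℝ f x) (v : E) :
    fderiv ℝ (fun p => ((f p : ℝ) : ℍ[ℝ])) x v = ((fderiv ℝ f x v : ℝ) : ℍ[ℝ]) := by
  have h := ((Algebra.linearMap ℝ ℍ[ℝ]).toContinuousLinearMap.hasFDerivAt.comp x hf.hasFDerivAt)
  exact congrArg (fun L : E →L[ℝ] ℍ[ℝ] => L v) h.fderiv

/-- Conjugate rule for real-valued functions: identifying `f : ℍ → ℝ` with the
`ℍ`-valued map `q ↦ ((f q : ℝ) : ℍ)`, we have
`star (∂f/∂q^μ(q)) = ∂f/∂q^{μ*}(q)` and `star (∂f/∂q^{μ*}(q)) = ∂f/∂q^μ(q)`. -/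
theorem ghr_conjugate_rule_real (f : ℍ[ℝ] → ℝ) (q : ℍ[ℝ]) (hf : DifferentiableAt ℝ f q)
    (μ : ℍ[ℝ]) (hμ : μ ≠ 0) :
    star (ghrD (fun p => ((f p : ℝ) : ℍ[ℝ])) μ q)
        = ghrDStar (fun p => ((f p : ℝ) : ℍ[ℝ])) μ q ∧
    star (ghrDStar (fun p => ((f p : ℝ) : ℍ[ℝ])) μ q)
        = ghrD (fun p => ((f p : ℝ) : ℍ[ℝ])) μ q := by
  have star_term (r : ℝ) {x : ℍ[ℝ]} (hx : star x = -x) :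
      star ((r : ℍ[ℝ]) * (μ * x * μ⁻¹)) = -((r : ℍ[ℝ]) * (μ * x * μ⁻¹)) := by
    rw [star_mul, Quaternion.star_conj_of_star_eq_neg hx, Quaternion.star_coe, neg_mul,
      Quaternion.coe_commutes]
  have h : star (ghrD (fun p => ((f p : ℝ) : ℍ[ℝ])) μ q)
      = ghrDStar (fun p => ((f p : ℝ) : ℍ[ℝ])) μ q := by
    simp only [ghrD, ghrDStar, fderiv_quaternion_coe_apply hf, Quaternion.star_smul, star_sub,
      star_term _ star_qi, star_term _ star_qj, star_term _ star_qk, Quaternion.star_coe,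
      sub_neg_eq_add]
  exact ⟨h, by rw [← h, star_star]⟩
end

section
/- Second-order commutativity of mixed GHR derivatives (generalized Laplacian identity): let f : ℍ → ℍ be twice continuously differentiable (ContDiff ℝ 2) and let μ ∈ ℍ be nonzero. Then for every q ∈ ℍ, 16 * ∂(p ↦ ∂f/∂p^{μ*}(p))/∂q^μ(q) = 16 * ∂(p ↦ ∂f/∂p^μ(p))/∂q^{μ*}(q) = D_1(D_1 f)(q) + D_i(D_i f)(q) + D_j(D_j f)(q) + D_k(D_k f)(q), where D_v(D_v f)(q) := fderiv ℝ (fun p => fderiv ℝ f p v) q v is the second partial derivative of f in direction v. -/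
open Quaternion

theorem qi_mul_qi : qi * qi = -1 := by
  ext <;> simp only [Quaternion.re_neg, Quaternion.imI_neg, Quaternion.imJ_neg, Quaternion.imK_neg,
    Quaternion.re_mul, Quaternion.imI_mul, Quaternion.imJ_mul, Quaternion.imK_mul] <;> simp [qi]

theorem qj_mul_qj : qj * qj = -1 := by
  ext <;> simp only [Quaternion.re_neg, Quaternion.imI_neg, Quaternion.imJ_neg, Quaternion.imK_neg,
    Quaternion.re_mul, Quaternion.imI_mul, Quaternion.imJ_mul, Quaternion.imK_mul] <;> simp [qj]

theorem qk_mul_qk : qk * qk = -1 := by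
  ext <;> simp only [Quaternion.re_neg, Quaternion.imI_neg, Quaternion.imJ_neg, Quaternion.imK_neg,
    Quaternion.re_mul, Quaternion.imI_mul, Quaternion.imJ_mul, Quaternion.imK_mul] <;> simp [qk]

theorem qj_mul_qi : qj * qi = -(qi * qj) := by
  ext <;> simp only [Quaternion.re_neg, Quaternion.imI_neg, Quaternion.imJ_neg, Quaternion.imK_neg,
    Quaternion.re_mul, Quaternion.imI_mul, Quaternion.imJ_mul, Quaternion.imK_mul] <;> simp [qi, qj]

theorem qk_mul_qi : qk * qi = -(qi * qk) := by
  ext <;> simp only [Quaternion.re_neg, Quaternion.imI_neg, Quaternion.imJ_neg, Quaternion.imK_neg,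
    Quaternion.re_mul, Quaternion.imI_mul, Quaternion.imJ_mul, Quaternion.imK_mul] <;> simp [qi, qk]

theorem qk_mul_qj : qk * qj = -(qj * qk) := by
  ext <;> simp only [Quaternion.re_neg, Quaternion.imI_neg, Quaternion.imJ_neg, Quaternion.imK_neg,
    Quaternion.re_mul, Quaternion.imI_mul, Quaternion.imJ_mul, Quaternion.imK_mul] <;> simp [qj, qk]

theorem conj_mul_conj {R : Type*} [DivisionRing R] {μ : R} (hμ : μ ≠ 0) (x y : R) :
    μ * x * μ⁻¹ * (μ * y * μ⁻¹) = μ * (x * y) * μ⁻¹ := by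
  simp only [mul_assoc, inv_mul_cancel_left₀ hμ]

theorem conj_mul_conj_of_mul_eq_neg_one {R : Type*} [DivisionRing R] {μ x : R} (hμ : μ ≠ 0)
    (h : x * x = -1) : μ * x * μ⁻¹ * (μ * x * μ⁻¹) = -1 := by
  simp [conj_mul_conj hμ, h, hμ]

theorem conj_mul_conj_of_mul_eq_neg {R : Type*} [DivisionRing R] {μ x y : R} (hμ : μ ≠ 0)
    (h : y * x = -(x * y)) :
    μ * y * μ⁻¹ * (μ * x * μ⁻¹) = -(μ * x * μ⁻¹ * (μ * y * μ⁻¹)) := by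
  simp only [conj_mul_conj hμ, h, mul_neg, neg_mul]

theorem hasFDerivAt_fderiv_apply {f : ℍ[ℝ] → ℍ[ℝ]} (hf : ContDiff ℝ 2 f) (q a : ℍ[ℝ]) :
    HasFDerivAt (fun p => fderiv ℝ f p a) ((fderiv ℝ (fderiv ℝ f) q).flip a) q := by
  have h : HasFDerivAt (fderiv ℝ f) (fderiv ℝ (fderiv ℝ f) q) q :=
    ((hf.fderiv_right (m := 1) (by norm_num)).differentiable (by norm_num) q).hasFDerivAt
  exact (h.clm_apply (hasFDerivAt_const a q)).congr_fderiv (by ext1 v; simp)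

theorem fderiv_fderiv_apply {f : ℍ[ℝ] → ℍ[ℝ]} (hf : ContDiff ℝ 2 f) (q a v : ℍ[ℝ]) :
    fderiv ℝ (fun p => fderiv ℝ f p a) q v = fderiv ℝ (fderiv ℝ f) q v a := by
  rw [(hasFDerivAt_fderiv_apply hf q a).fderiv]
  rfl

theorem fderiv_fderiv_comm {f : ℍ[ℝ] → ℍ[ℝ]} (hf : ContDiff ℝ 2 f) (q v w : ℍ[ℝ]) :
    fderiv ℝ (fderiv ℝ f) q v w = fderiv ℝ (fderiv ℝ f) q w v :=
  (hf.contDiffAt.isSymmSndFDerivAt (by simp)) v w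

theorem fderiv_ghrD {f : ℍ[ℝ] → ℍ[ℝ]} (hf : ContDiff ℝ 2 f) (μ q v : ℍ[ℝ]) :
    fderiv ℝ (fun p => ghrD f μ p) q v = (4 : ℝ)⁻¹ • (fderiv ℝ (fderiv ℝ f) q v 1
      - fderiv ℝ (fderiv ℝ f) q v qi * (μ * qi * μ⁻¹)
      - fderiv ℝ (fderiv ℝ f) q v qj * (μ * qj * μ⁻¹)
      - fderiv ℝ (fderiv ℝ f) q v qk * (μ * qk * μ⁻¹)) := by
  have h := hasFDerivAt_fderiv_apply hf q
  have hd := (((((h 1).sub ((h qi).mul_const' (μ * qi * μ⁻¹))).sub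
    ((h qj).mul_const' (μ * qj * μ⁻¹))).sub ((h qk).mul_const' (μ * qk * μ⁻¹))).const_smul
    (4 : ℝ)⁻¹).fderiv
  exact congrArg (fun L : ℍ[ℝ] →L[ℝ] ℍ[ℝ] => L v) hd

theorem fderiv_ghrDStar {f : ℍ[ℝ] → ℍ[ℝ]} (hf : ContDiff ℝ 2 f) (μ q v : ℍ[ℝ]) :
    fderiv ℝ (fun p => ghrDStar f μ p) q v = (4 : ℝ)⁻¹ • (fderiv ℝ (fderiv ℝ f) q v 1
      + fderiv ℝ (fderiv ℝ f) q v qi * (μ * qi * μ⁻¹)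
      + fderiv ℝ (fderiv ℝ f) q v qj * (μ * qj * μ⁻¹)
      + fderiv ℝ (fderiv ℝ f) q v qk * (μ * qk * μ⁻¹)) := by
  have h := hasFDerivAt_fderiv_apply hf q
  have hd := (((((h 1).add ((h qi).mul_const' (μ * qi * μ⁻¹))).add
    ((h qj).mul_const' (μ * qj * μ⁻¹))).add ((h qk).mul_const' (μ * qk * μ⁻¹))).const_smul
    (4 : ℝ)⁻¹).fderiv
  exact congrArg (fun L : ℍ[ℝ] →L[ℝ] ℍ[ℝ] => L v) hd

/-- Second-order commutativity of the mixed GHR derivatives and the generalized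
Laplacian identity:
`16 ∂²f/(∂q^μ ∂q^{μ*}) = 16 ∂²f/(∂q^{μ*} ∂q^μ) = ∂²f/∂q_a² + ∂²f/∂q_b² + ∂²f/∂q_c² + ∂²f/∂q_d²`. -/
theorem ghr_second_order_commute (f : ℍ[ℝ] → ℍ[ℝ]) (hf : ContDiff ℝ 2 f)
    (μ : ℍ[ℝ]) (hμ : μ ≠ 0) (q : ℍ[ℝ]) :
    16 * ghrD (fun p => ghrDStar f μ p) μ q = 16 * ghrDStar (fun p => ghrD f μ p) μ q ∧
    16 * ghrDStar (fun p => ghrD f μ p) μ q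
      = fderiv ℝ (fun p => fderiv ℝ f p 1) q 1
      + fderiv ℝ (fun p => fderiv ℝ f p qi) q qi
      + fderiv ℝ (fun p => fderiv ℝ f p qj) q qj
      + fderiv ℝ (fun p => fderiv ℝ f p qk) q qk := by
  have hii := conj_mul_conj_of_mul_eq_neg_one hμ qi_mul_qi
  have hjj := conj_mul_conj_of_mul_eq_neg_one hμ qj_mul_qj
  have hkk := conj_mul_conj_of_mul_eq_neg_one hμ qk_mul_qk
  have hji := conj_mul_conj_of_mul_eq_neg hμ qj_mul_qi
  have hki := conj_mul_conj_of_mul_eq_neg hμ qk_mul_qi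
  have hkj := conj_mul_conj_of_mul_eq_neg hμ qk_mul_qj
  have h16 (x : ℍ[ℝ]) : 16 * x = (16 : ℝ) • x := by
    rw [← Quaternion.coe_mul_eq_smul]; norm_cast
  rw [ghrD, ghrDStar]
  simp only [h16, fderiv_ghrD hf, fderiv_ghrDStar hf, fderiv_fderiv_apply hf]
  rw [fderiv_fderiv_comm hf q qi 1, fderiv_fderiv_comm hf q qj 1, fderiv_fderiv_comm hf q qk 1,
    fderiv_fderiv_comm hf q qj qi, fderiv_fderiv_comm hf q qk qi, fderiv_fderiv_comm hf q qk qj]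
  generalize μ * qi * μ⁻¹ = a at *
  generalize μ * qj * μ⁻¹ = b at *
  generalize μ * qk * μ⁻¹ = c at *
  constructor <;>
  · simp only [smul_mul_assoc, add_mul, sub_mul, mul_assoc, hii, hjj, hkk, hji, hki, hkj,
      mul_neg, mul_one]
    module
end

section
/- QLMS gradient: let N ∈ ℕ, let d ∈ ℍ and x, w : Fin N → ℍ, and set e := d − Σ_n (w n) * (x n). For each index n, define the real-valued cost as a function of the n-th weight, φ_n : ℍ → ℝ, φ_n(p) := normSq(d − Σ_m c_m * (x m)) where c_m = p if m = n and c_m = w m otherwise. Then, identifying φ_n with q ↦ ((φ_n q : ℝ) : ℍ), its GHR derivatives at w n satisfy ∂φ_n/∂p(w n) = −(1/2) * (x n) * (star e) and ∂φ_n/∂p^*(w n) = −(1/2) * e * star (x n). -/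
open Quaternion

/-- The derivative of `p ↦ |e - (p - w) x|²` at `w` in the direction `v` is `-2 Re (v x e^*)`. -/
theorem fderiv_coe_normSq_sub_mul (e x w v : ℍ[ℝ]) :
    fderiv ℝ (fun p : ℍ[ℝ] => ((Quaternion.normSq (e - (p - w) * x) : ℝ) : ℍ[ℝ])) w v
      = ((-2 * (v * (x * star e)).re : ℝ) : ℍ[ℝ]) := by
  have hu : HasFDerivAt (fun p : ℍ[ℝ] => e - (p - w) * x)
      (-((ContinuousLinearMap.mul ℝ ℍ[ℝ]).flip x)) w :=
    ((((ContinuousLinearMap.mul ℝ ℍ[ℝ]).flip x).hasFDerivAt).comp w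
      ((hasFDerivAt_id w).sub_const w)).const_sub e
  have hf := ((algebraMapCLM ℝ ℍ[ℝ]).hasFDerivAt).comp w hu.norm_sq
  have hfun : (fun p : ℍ[ℝ] => ((Quaternion.normSq (e - (p - w) * x) : ℝ) : ℍ[ℝ]))
      = (algebraMapCLM ℝ ℍ[ℝ]) ∘ fun p => ‖e - (p - w) * x‖ ^ 2 := by
    funext p
    rw [Quaternion.normSq_eq_norm_mul_self, ← sq]
    rfl
  rw [hfun, hf.fderiv]
  change ((_ : ℝ) : ℍ[ℝ]) = _
  congr 1
  simp [Quaternion.inner_def]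
  ring

/-- Replacing the `n`-th weight by `p` changes the error `d - ∑ w_m x_m` by `-(p - w_n) x_n`. -/
theorem sub_sum_ite_mul {R ι : Type*} [Ring R] [Fintype ι] [DecidableEq ι] (d : R) (x w : ι → R)
    (n : ι) (p : R) :
    d - ∑ m, (if m = n then p else w m) * x m = d - ∑ m, w m * x m - (p - w n) * x n := by
  have h : ∀ m, (if m = n then p else w m) * x m
      = w m * x m + if m = n then (p - w n) * x n else 0 := by
    intro m
    split_ifs with hm
    · subst hm; noncomm_ring
    · simp
  simp only [h, Finset.sum_add_distrib, Finset.sum_ite_eq', Finset.mem_univ, if_true]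
  abel

/-- QLMS gradient: with error `e = d − Σ_m w_m x_m` and per-coordinate cost
`φ_n(p) = |d − Σ_m c_m x_m|²` (`c_m = p` if `m = n`, else `c_m = w_m`), the GHR
derivatives at `w n` are `∂φ_n/∂p(w n) = −(1/2) x_n e^*` and
`∂φ_n/∂p^*(w n) = −(1/2) e x_n^*`. -/
theorem qlms_gradient (N : ℕ) (d : ℍ[ℝ]) (x w : Fin N → ℍ[ℝ]) (n : Fin N)
    (e : ℍ[ℝ]) (he : e = d - ∑ m, w m * x m) :
    ghrD (fun p => ((Quaternion.normSq
        (d - ∑ m, (if m = n then p else w m) * x m) : ℝ) : ℍ[ℝ])) 1 (w n)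
      = -(1 / 2 : ℍ[ℝ]) * (x n * star e) ∧
    ghrDStar (fun p => ((Quaternion.normSq
        (d - ∑ m, (if m = n then p else w m) * x m) : ℝ) : ℍ[ℝ])) 1 (w n)
      = -(1 / 2 : ℍ[ℝ]) * (e * star (x n)) := by
  have half (y : ℍ[ℝ]) : -(1 / 2 : ℍ[ℝ]) * y = (-(1 / 2) : ℝ) • y := by
    rw [← Quaternion.coe_mul_eq_smul]
    push_cast
    rfl
  have hstar : e * star (x n) = star (x n * star e) := by simp
  simp only [sub_sum_ite_mul, ← he, ghrD, ghrDStar, fderiv_coe_normSq_sub_mul, hstar, half,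
    inv_one, one_mul, mul_one]
  generalize x n * star e = g
  constructor <;> ext <;> simp <;> ring
end

section
/- Quaternion least squares: let M, N ∈ ℕ, let A be an M×N matrix over ℍ and b : Fin M → ℍ, and suppose the N×N quaternion matrix Aᴴ * A is invertible. Define F : (Fin N → ℍ) → ℝ by F(q) := Σ_m normSq(b m − (A.mulVec q) m), and set q₀ := (⅟(Aᴴ * A)).mulVec (Aᴴ.mulVec b). Then q₀ satisfies the normal equation (Aᴴ * A).mulVec q₀ = Aᴴ.mulVec b, and q₀ is the unique global minimizer of F: for every q : Fin N → ℍ, F(q₀) ≤ F(q), with equality if and only if q = q₀. -/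
open Quaternion Matrix

/-- Pythagoras' theorem for orthogonal quaternion vectors. -/
theorem sum_normSq_add_of_star_dotProduct_eq_zero {ι : Type*} [Fintype ι] {v w : ι → ℍ[ℝ]}
    (h : star w ⬝ᵥ v = 0) :
    ∑ i, Quaternion.normSq (v i + w i) =
      ∑ i, Quaternion.normSq (v i) + ∑ i, Quaternion.normSq (w i) := by
  have hre : ∑ i, (v i * star (w i)).re = 0 := by
    have key : ∀ i, (v i * star (w i)).re = (star (w i) * v i).re := fun i => by
      simp only [Quaternion.re_mul]
      ring
    simp_rw [key]
    refine (map_sum (AddMonoidHom.mk' (fun q : ℍ[ℝ] => q.re) fun _ _ => rfl)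
      (fun i => star (w i) * v i) Finset.univ).symm.trans ?_
    exact congrArg (fun q : ℍ[ℝ] => q.re) h
  simp_rw [Quaternion.normSq_add, Finset.sum_add_distrib, ← Finset.mul_sum, hre]
  simp

theorem sum_normSq_eq_zero_iff {ι : Type*} [Fintype ι] {v : ι → ℍ[ℝ]} :
    ∑ i, Quaternion.normSq (v i) = 0 ↔ v = 0 := by
  rw [Finset.sum_eq_zero_iff_of_nonneg fun i _ => Quaternion.normSq_nonneg]
  simp [funext_iff]

/-- The residual of a solution of the normal equation is orthogonal to the range of `A`. -/
theorem star_mulVec_dotProduct_residual {R m n : Type*} [Ring R] [StarRing R]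
    [Fintype m] [Fintype n] {A : Matrix m n R} {b : m → R} {x : n → R}
    (h : (Aᴴ * A).mulVec x = Aᴴ.mulVec b) (d : n → R) :
    star (A.mulVec d) ⬝ᵥ (b - A.mulVec x) = 0 := by
  rw [star_mulVec, ← dotProduct_mulVec, mulVec_sub, mulVec_mulVec, h, sub_self, dotProduct_zero]

theorem mulVec_eq_zero_iff_of_invertible_gram {R m n : Type*} [Ring R] [StarRing R]
    [Fintype m] [Fintype n] [DecidableEq n] (A : Matrix m n R) [Invertible (Aᴴ * A)] {d : n → R} :
    A.mulVec d = 0 ↔ d = 0 := by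
  refine ⟨fun h => ?_, fun h => by rw [h, mulVec_zero]⟩
  rw [← one_mulVec d, ← invOf_mul_self (Aᴴ * A), ← mulVec_mulVec, ← mulVec_mulVec, h,
    mulVec_zero, mulVec_zero]

/-- Quaternion least squares: if `Aᴴ A` is invertible then
`q₀ = (Aᴴ A)⁻¹ Aᴴ b` satisfies the normal equation `Aᴴ A q₀ = Aᴴ b` and is the
unique global minimizer of `F(q) = Σ_m |b_m − (A q)_m|²`. -/
theorem quaternion_least_squares (M N : ℕ)
    (A : Matrix (Fin M) (Fin N) ℍ[ℝ]) (b : Fin M → ℍ[ℝ])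
    [Invertible (Aᴴ * A)]
    (F : (Fin N → ℍ[ℝ]) → ℝ)
    (hF : ∀ q, F q = ∑ m, Quaternion.normSq (b m - A.mulVec q m))
    (q₀ : Fin N → ℍ[ℝ])
    (hq₀ : q₀ = (⅟(Aᴴ * A)).mulVec (Aᴴ.mulVec b)) :
    (Aᴴ * A).mulVec q₀ = Aᴴ.mulVec b ∧
    ∀ q : Fin N → ℍ[ℝ], F q₀ ≤ F q ∧ (F q₀ = F q ↔ q = q₀) := by
  have normal : (Aᴴ * A).mulVec q₀ = Aᴴ.mulVec b := by
    rw [hq₀, mulVec_mulVec, mul_invOf_self, one_mulVec]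
  refine ⟨normal, fun q => ?_⟩
  have hFq : F q = F q₀ + ∑ m, Quaternion.normSq (A.mulVec (q₀ - q) m) := by
    rw [hF, hF]
    have pyth := sum_normSq_add_of_star_dotProduct_eq_zero
      (star_mulVec_dotProduct_residual normal (q₀ - q))
    simp only [Pi.sub_apply] at pyth
    rw [← pyth]
    simp only [mulVec_sub, Pi.sub_apply, sub_add_sub_cancel]
  refine ⟨?_, ?_⟩
  · rw [hFq]
    exact le_add_of_nonneg_right (Finset.sum_nonneg fun m _ => Quaternion.normSq_nonneg)
  · rw [hFq, left_eq_add, sum_normSq_eq_zero_iff, mulVec_eq_zero_iff_of_invertible_gram,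
      sub_eq_zero, eq_comm]
end
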